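/- arXiv:2011.09691 — 2 statements merged into one kernel-verified Lean document; each statement's English description precedes it below -/
import Mathlib

section
/- For every complex number s with Re s > −1 and s ∉ {0, 1}, the integral ∫_{1}^{∞} ({x}² − {x}) / x^{s+2} dx converges absolutely and ζ(s) = s/(s−1) − 1/2 − (s(s+1)/2) ∫_{1}^{∞} ({x}² − {x}) / x^{s+2} dx. -/
open Filter Finset MeasureTheory

/-- The weight `{x}² - {x}` cut off to `x > 1`. -/
noncomputable def fractWeight : ℝ → ℂ :=
  (Set.Ioi (1 : ℝ)).indicator fun x => ((Int.fract x ^ 2 - Int.fract x : ℝ) : ℂ)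

lemma norm_fract_sq_sub_fract_le (x : ℝ) :
    ‖((Int.fract x ^ 2 - Int.fract x : ℝ) : ℂ)‖ ≤ 1 := by
  rw [Complex.norm_real, Real.norm_eq_abs, abs_le]
  have h0 := Int.fract_nonneg x
  have h1 := Int.fract_lt_one x
  constructor <;> nlinarith

lemma norm_fractWeight_le (x : ℝ) : ‖fractWeight x‖ ≤ 1 :=
  (norm_indicator_le_norm_self _ x).trans (norm_fract_sq_sub_fract_le x)

lemma measurable_fractWeight : Measurable fractWeight := by
  unfold fractWeight
  exact Measurable.indicator (by fun_prop) measurableSet_Ioi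

lemma locallyIntegrableOn_fractWeight : LocallyIntegrableOn fractWeight (Set.Ioi 0) := by
  refine LocallyIntegrable.locallyIntegrableOn ?_ _
  refine (locallyIntegrable_const (1 : ℝ)).mono measurable_fractWeight.aestronglyMeasurable ?_
  exact Eventually.of_forall fun x => by simpa using norm_fractWeight_le x

lemma fractWeight_isBigO_atTop :
    fractWeight =O[atTop] fun x : ℝ => x ^ (-(0 : ℝ)) :=
  Asymptotics.IsBigO.of_bound 1 (Eventually.of_forall fun x => by
    simpa using norm_fractWeight_le x)

lemma fractWeight_isBigO_zero (b : ℝ) :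
    fractWeight =O[nhdsWithin 0 (Set.Ioi 0)] fun x : ℝ => x ^ (-b) := by
  refine Asymptotics.IsBigO.of_bound 1 ?_
  filter_upwards [mem_nhdsWithin_of_mem_nhds (Iio_mem_nhds (zero_lt_one' ℝ))] with x hx
  have : fractWeight x = 0 := Set.indicator_of_notMem (by simpa using le_of_lt hx) _
  rw [this]
  simp

lemma differentiableAt_mellin_fractWeight {z : ℂ} (hz : z.re < 0) :
    DifferentiableAt ℂ (mellin fractWeight) z :=
  mellin_differentiableAt_of_isBigO_rpow locallyIntegrableOn_fractWeight
    fractWeight_isBigO_atTop hz (fractWeight_isBigO_zero _) (sub_one_lt z.re)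

lemma mellinConvergent_fractWeight {z : ℂ} (hz : z.re < 0) : MellinConvergent fractWeight z :=
  mellinConvergent_of_isBigO_rpow locallyIntegrableOn_fractWeight
    fractWeight_isBigO_atTop hz (fractWeight_isBigO_zero _) (sub_one_lt z.re)

lemma mellin_integrand_fractWeight (s : ℂ) :
    (fun x : ℝ => (x : ℂ) ^ (-s - 1 - 1) • fractWeight x) =
      (Set.Ioi (1 : ℝ)).indicator
        (fun x : ℝ => ((Int.fract x ^ 2 - Int.fract x : ℝ) : ℂ) / (x : ℂ) ^ (s + 2)) := by
  ext x
  by_cases hx : x ∈ Set.Ioi (1 : ℝ)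
  · rw [fractWeight, Set.indicator_of_mem hx, Set.indicator_of_mem hx,
      show -s - 1 - 1 = -(s + 2) by ring, Complex.cpow_neg, smul_eq_mul, div_eq_mul_inv, mul_comm]
  · rw [fractWeight, Set.indicator_of_notMem hx, Set.indicator_of_notMem hx, smul_zero]

lemma Ioi_one_inter_Ioi_zero : Set.Ioi (1 : ℝ) ∩ Set.Ioi 0 = Set.Ioi 1 :=
  Set.inter_eq_left.2 (Set.Ioi_subset_Ioi zero_le_one)

lemma integrableOn_fract_sq_sub_fract_div_cpow {s : ℂ} (hs : -1 < s.re) :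
    IntegrableOn
      (fun x : ℝ => ((Int.fract x ^ 2 - Int.fract x : ℝ) : ℂ) / (x : ℂ) ^ (s + 2))
      (Set.Ioi (1 : ℝ)) := by
  have h := mellinConvergent_fractWeight (z := -s - 1) (by simp; linarith)
  rwa [MellinConvergent, mellin_integrand_fractWeight, integrableOn_indicator_iff
    measurableSet_Ioi, Ioi_one_inter_Ioi_zero] at h

lemma mellin_fractWeight (s : ℂ) :
    mellin fractWeight (-s - 1) = ∫ x in Set.Ioi (1 : ℝ),
      ((Int.fract x ^ 2 - Int.fract x : ℝ) : ℂ) / (x : ℂ) ^ (s + 2) := by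
  rw [mellin, mellin_integrand_fractWeight, setIntegral_indicator measurableSet_Ioi,
    Set.inter_comm, Ioi_one_inter_Ioi_zero]

lemma hasDerivAt_primitive_sq_sub_div_cpow {s : ℂ} (hs0 : s ≠ 0) (hs1 : s ≠ 1)
    (hs2 : s ≠ -1) (a : ℂ) {x : ℝ} (hx : 0 < x) :
    HasDerivAt (fun y : ℝ => -(s / 2) * (((y : ℂ) - a) ^ 2 - (y - a)) * (y : ℂ) ^ (-s - 1)
        - 1 / 2 * (2 * ((y : ℂ) - a) - 1) * (y : ℂ) ^ (-s) + (y : ℂ) ^ (1 - s) / (1 - s))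
      (s * (s + 1) / 2 * ((((x : ℂ) - a) ^ 2 - (x - a)) / (x : ℂ) ^ (s + 2))) x := by
  have hs1' : 1 - s ≠ 0 := sub_ne_zero.2 hs1.symm
  have hs2' : -s - 1 ≠ 0 := fun h => hs2 (by linear_combination -h)
  have hl : HasDerivAt (fun y : ℝ => (y : ℂ) - a) 1 x :=
    (HasDerivAt.ofReal_comp (hasDerivAt_id x)).sub_const a
  have hA := hasDerivAt_ofReal_cpow_const hx.ne' hs2'
  have hB := hasDerivAt_ofReal_cpow_const hx.ne' (neg_ne_zero.2 hs0)
  have hC := hasDerivAt_ofReal_cpow_const hx.ne' hs1'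
  have key := (((((hl.pow 2).sub hl).const_mul (-(s / 2))).mul hA).sub
    ((((hl.const_mul 2).sub_const 1).const_mul (1 / 2 : ℂ)).mul hB)).add (hC.div_const (1 - s))
  refine key.congr_deriv ?_
  have e1 : (x : ℂ) ^ (-s - 1 - 1) = ((x : ℂ) ^ (s + 2))⁻¹ := by
    rw [← Complex.cpow_neg]; ring_nf
  rw [show 1 - s - 1 = -s by ring, e1]
  simp
  field_simp
  ring

lemma intervalIntegral_sq_sub_div_cpow {s : ℂ} (hs0 : s ≠ 0) (hs1 : s ≠ 1) (hs2 : s ≠ -1)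
    {a : ℝ} (ha : 0 < a) :
    s * (s + 1) / 2 * ∫ x in a..a + 1, (((x : ℂ) - a) ^ 2 - (x - a)) / (x : ℂ) ^ (s + 2) =
      ((a + 1 : ℝ) : ℂ) ^ (1 - s) / (1 - s) - (a : ℂ) ^ (1 - s) / (1 - s)
        - 1 / 2 * ((a + 1 : ℝ) : ℂ) ^ (-s) - 1 / 2 * (a : ℂ) ^ (-s) := by
  have hpos : ∀ x ∈ Set.uIcc a (a + 1), 0 < x := fun x hx => by
    rw [Set.uIcc_of_le (by linarith)] at hx
    exact ha.trans_le hx.1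
  rw [← intervalIntegral.integral_const_mul, intervalIntegral.integral_eq_sub_of_hasDerivAt
    fun x hx => hasDerivAt_primitive_sq_sub_div_cpow hs0 hs1 hs2 a (hpos x hx)]
  · push_cast
    ring
  · refine ContinuousOn.intervalIntegrable fun x hx => ContinuousAt.continuousWithinAt ?_
    have hx0 := hpos x hx
    have hc : ContinuousAt (fun x : ℝ => (x : ℂ) ^ (s + 2)) x :=
      Complex.continuous_ofReal.continuousAt.cpow continuousAt_const (Or.inl (by simpa using hx0))
    have hne : (x : ℂ) ^ (s + 2) ≠ 0 := by
      simp [Complex.cpow_eq_zero_iff, hx0.ne']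
    exact continuousAt_const.mul (ContinuousAt.div (by fun_prop) hc hne)

lemma intervalIntegral_fract_sq_sub_fract_div_cpow {s : ℂ} (hs : -1 < s.re) (hs0 : s ≠ 0)
    (hs1 : s ≠ 1) (N : ℕ) :
    s * (s + 1) / 2 * ∫ x in (1 : ℝ)..((N : ℝ) + 1),
        ((Int.fract x ^ 2 - Int.fract x : ℝ) : ℂ) / (x : ℂ) ^ (s + 2) =
      1 / 2 - 1 / (1 - s) - ∑ n ∈ range (N + 1), 1 / ((n : ℂ) + 1) ^ s
        + 1 / 2 * (((N : ℝ) + 1 : ℝ) : ℂ) ^ (-s)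
        + (((N : ℝ) + 1 : ℝ) : ℂ) ^ (1 - s) / (1 - s) := by
  have hs2 : s ≠ -1 := by rintro rfl; simp at hs
  have hint {a b : ℝ} (ha : 1 ≤ a) (hb : 1 ≤ b) : IntervalIntegrable
      (fun x : ℝ => ((Int.fract x ^ 2 - Int.fract x : ℝ) : ℂ) / (x : ℂ) ^ (s + 2)) volume a b :=
    intervalIntegrable_iff.2 <| (integrableOn_fract_sq_sub_fract_div_cpow hs).mono_set
      fun x hx => (le_min ha hb).trans_lt hx.1
  induction N with
  | zero => simp; ring
  | succ N ih =>
    have hN : (0 : ℝ) ≤ N := N.cast_nonneg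
    rw [← intervalIntegral.integral_add_adjacent_intervals
      (hint le_rfl (by linarith : (1 : ℝ) ≤ N + 1)) (hint (by linarith) (by push_cast; linarith)),
      mul_add, ih, sum_range_succ _ (N + 1)]
    have hcongr : ∫ x in ((N : ℝ) + 1)..(((N + 1 : ℕ) : ℝ) + 1),
          ((Int.fract x ^ 2 - Int.fract x : ℝ) : ℂ) / (x : ℂ) ^ (s + 2) =
        ∫ x in ((N : ℝ) + 1)..((N : ℝ) + 1 + 1),
          (((x : ℂ) - ((N : ℝ) + 1 : ℝ)) ^ 2 - (x - ((N : ℝ) + 1 : ℝ))) / (x : ℂ) ^ (s + 2) := by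
      push_cast
      refine intervalIntegral.integral_congr_Ioo_of_le (by linarith) fun x hx => ?_
      have hfl : Int.fract x = x - (N + 1) := by
        rw [Int.fract_eq_iff]
        exact ⟨by linarith [hx.1], by linarith [hx.2], N + 1, by push_cast; ring⟩
      simp only [hfl]
      push_cast
      ring
    rw [hcongr, intervalIntegral_sq_sub_div_cpow hs0 hs1 hs2 (by linarith)]
    push_cast
    rw [Complex.cpow_neg ((N : ℂ) + 1 + 1)]
    ring

lemma tendsto_natCast_add_one_cpow_zero {w : ℂ} (hw : w.re < 0) :
    Tendsto (fun N : ℕ => (((N : ℝ) + 1 : ℝ) : ℂ) ^ w) atTop (nhds 0) := by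
  rw [tendsto_zero_iff_norm_tendsto_zero]
  have h := (tendsto_rpow_neg_atTop (neg_pos.2 hw)).comp
    (tendsto_atTop_add_const_right _ (1 : ℝ) tendsto_natCast_atTop_atTop)
  refine h.congr fun N => ?_
  rw [Complex.norm_cpow_eq_rpow_re_of_pos (by positivity)]
  simp

lemma riemannZeta_eq_of_one_lt_re {s : ℂ} (hs : 1 < s.re) :
    riemannZeta s = s / (s - 1) - 1 / 2 - (s * (s + 1) / 2) * mellin fractWeight (-s - 1) := by
  have hs0 : s ≠ 0 := by rintro rfl; norm_num at hs
  have hs1 : s ≠ 1 := by rintro rfl; norm_num at hs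
  have hsum : Summable fun n : ℕ => 1 / ((n : ℂ) + 1) ^ s := by
    simpa using (summable_nat_add_iff 1).2 (Complex.summable_one_div_nat_cpow.2 hs)
  have hzeta := (hsum.hasSum.tendsto_sum_nat.comp (tendsto_add_atTop_nat 1))
  rw [← zeta_eq_tsum_one_div_nat_add_one_cpow hs] at hzeta
  have hleft := (intervalIntegral_tendsto_integral_Ioi 1
    (integrableOn_fract_sq_sub_fract_div_cpow (by linarith : -1 < s.re))
    (tendsto_atTop_add_const_right _ (1 : ℝ) tendsto_natCast_atTop_atTop)).const_mul
      (s * (s + 1) / 2)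
  have hright := ((hzeta.const_sub (1 / 2 - 1 / (1 - s))).add
    ((tendsto_natCast_add_one_cpow_zero (w := -s) (by simp; linarith)).const_mul (1 / 2))).add
    ((tendsto_natCast_add_one_cpow_zero (w := 1 - s) (by simpa using hs)).div_const (1 - s))
  have h := tendsto_nhds_unique hleft (hright.congr fun N =>
    (intervalIntegral_fract_sq_sub_fract_div_cpow (by linarith) hs0 hs1 N).symm)
  rw [mellin_fractWeight, h]
  have h1 : s - 1 ≠ 0 := sub_ne_zero.2 hs1
  have h2 : 1 - s ≠ 0 := sub_ne_zero.2 hs1.symm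
  field_simp
  ring

lemma riemannZeta₁_eq_of_neg_one_lt_re {s : ℂ} (hs : -1 < s.re) :
    riemannZeta₁ s = s - (s - 1) / 2
      - (s - 1) * (s * (s + 1) / 2) * mellin fractWeight (-s - 1) := by
  have hopen : IsOpen {z : ℂ | -1 < z.re} := isOpen_lt continuous_const Complex.continuous_re
  refine AnalyticOnNhd.eqOn_of_preconnected_of_eventuallyEq (U := {z : ℂ | -1 < z.re}) (z₀ := 2)
    (f := riemannZeta₁) (g := fun s => s - (s - 1) / 2
      - (s - 1) * (s * (s + 1) / 2) * mellin fractWeight (-s - 1))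
    (differentiable_riemannZeta₁.differentiableOn.analyticOnNhd hopen)
    (DifferentiableOn.analyticOnNhd (fun z hz => ?_) hopen)
    (convex_halfSpace_re_gt (-1)).isPreconnected (by norm_num) ?_ hs
  · have hm : DifferentiableAt ℂ (fun z => mellin fractWeight (-z - 1)) z :=
      DifferentiableAt.comp z (f := fun z : ℂ => -z - 1)
        (differentiableAt_mellin_fractWeight (by
          have hz' : -1 < z.re := hz
          simp; linarith)) (by fun_prop)
    exact DifferentiableAt.differentiableWithinAt (by fun_prop)
  · filter_upwards [(isOpen_lt continuous_const Complex.continuous_re).mem_nhds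
      (show (2 : ℂ) ∈ {z : ℂ | 1 < z.re} by norm_num)] with z hz
    have hz1 : z ≠ 1 := by rintro rfl; norm_num at hz
    have h := riemannZeta_eq_of_one_lt_re hz
    rw [riemannZeta_eq_inv_sub_mul hz1] at h
    have h1 : z - 1 ≠ 0 := sub_ne_zero.2 hz1
    field_simp at h ⊢
    linear_combination h

theorem statement14 (s : ℂ) (hs : -1 < s.re) (hs0 : s ≠ 0) (hs1 : s ≠ 1) :
    IntegrableOn
      (fun x : ℝ => ((Int.fract x ^ 2 - Int.fract x : ℝ) : ℂ) / (x : ℂ) ^ (s + 2))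
      (Set.Ioi (1 : ℝ)) ∧
    riemannZeta s = s / (s - 1) - 1 / 2 -
      (s * (s + 1) / 2) *
        ∫ x in Set.Ioi (1 : ℝ),
          ((Int.fract x ^ 2 - Int.fract x : ℝ) : ℂ) / (x : ℂ) ^ (s + 2) := by
  refine ⟨integrableOn_fract_sq_sub_fract_div_cpow hs, ?_⟩
  rw [riemannZeta_eq_inv_sub_mul hs1, riemannZeta₁_eq_of_neg_one_lt_re hs, mellin_fractWeight]
  have h1 : s - 1 ≠ 0 := sub_ne_zero.2 hs1
  field_simp
end

section
/- For every nonnegative integer m, Parseval's identity for the fractional part function in the weighted space reads: ∑_{n=0}^{∞} C(n+m, m) · (ℓ_n^{(m)})² = (1/m!) ∫_{1}^{∞} {x}² (log x)^m / x² dx, where both sides are finite; moreover ℓ_n^{(m)} = ((−1)^{n−1} / (m! · C(n+m,m))) ∫_{1}^{∞} {x} (log x)^m L_n^{(m)}(log x) / x² dx for all n ≥ 0. -/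
open Filter Finset MeasureTheory

/-- The Stieltjes constants `γ_n`. -/
noncomputable def stieltjes (n : ℕ) : ℝ :=
  limUnder atTop (fun N : ℕ =>
    (∑ k ∈ Finset.range N, Real.log ((k : ℝ) + 1) ^ n / ((k : ℝ) + 1)) -
      Real.log (N : ℝ) ^ (n + 1) / ((n : ℝ) + 1))
/-- The coefficients `ℓ_n^{(m)} = -δ_{n,0} + ∑_{k=0}^n C(n,k) (-1)^{n-k} ∑_{j=0}^{m+k} γ_j/j!`. -/
noncomputable def ellGen (n m : ℕ) : ℝ :=
  -(if n = 0 then (1 : ℝ) else 0) + ∑ k ∈ Finset.range (n + 1),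
    (n.choose k : ℝ) * (-1 : ℝ) ^ (n - k) *
      ∑ j ∈ Finset.range (m + k + 1), stieltjes j / (Nat.factorial j : ℝ)
/-- The associated Laguerre polynomial `L_n^{(m)}(u) = ∑_{k=0}^n C(n+m, n-k) (-1)^k u^k / k!`. -/
noncomputable def assocLaguerre (m n : ℕ) (u : ℝ) : ℝ :=
  ∑ k ∈ Finset.range (n + 1),
    ((n + m).choose (n - k) : ℝ) * (-1 : ℝ) ^ k * u ^ k / (Nat.factorial k : ℝ)

open scoped Topology

/-- The measure `u ^ m * exp (-u) du` on the positive half-line. -/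
noncomputable def laguerreMeasure (m : ℕ) : Measure ℝ :=
  (volume.restrict (Set.Ioi 0)).withDensity fun u => ENNReal.ofReal (u ^ m * Real.exp (-u))

lemma measurable_laguerreDensity (m : ℕ) :
    Measurable fun u : ℝ => ENNReal.ofReal (u ^ m * Real.exp (-u)) := by fun_prop

lemma integral_laguerreMeasure (m : ℕ) (f : ℝ → ℝ) :
    ∫ u, f u ∂laguerreMeasure m = ∫ u in Set.Ioi 0, f u * (u ^ m * Real.exp (-u)) := by
  rw [laguerreMeasure, integral_withDensity_eq_integral_toReal_smul (measurable_laguerreDensity m)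
    (ae_of_all _ fun _ => ENNReal.ofReal_lt_top)]
  refine setIntegral_congr_fun measurableSet_Ioi fun u hu => ?_
  have hu' : (0 : ℝ) < u := hu
  simp only [smul_eq_mul]
  rw [ENNReal.toReal_ofReal (by positivity), mul_comm]

lemma integrable_laguerreMeasure_iff (m : ℕ) (f : ℝ → ℝ) :
    Integrable f (laguerreMeasure m) ↔
      IntegrableOn (fun u => f u * (u ^ m * Real.exp (-u))) (Set.Ioi 0) := by
  rw [laguerreMeasure, integrable_withDensity_iff (measurable_laguerreDensity m)
    (ae_of_all _ fun _ => ENNReal.ofReal_lt_top)]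
  refine integrableOn_congr_fun (fun u hu => ?_) measurableSet_Ioi
  have hu' : (0 : ℝ) < u := hu
  rw [ENNReal.toReal_ofReal (by positivity)]

lemma exp_smul_comp_exp (m : ℕ) (g : ℝ → ℝ) (u : ℝ) :
    Real.exp u • (g (Real.exp u) * Real.log (Real.exp u) ^ m / Real.exp u ^ 2) =
      g (Real.exp u) * (u ^ m * Real.exp (-u)) := by
  rw [Real.log_exp, Real.exp_neg, smul_eq_mul]
  field_simp

lemma integral_log_pow_div_sq (m : ℕ) (g : ℝ → ℝ) :
    ∫ x in Set.Ioi (1 : ℝ), g x * Real.log x ^ m / x ^ 2 =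
      ∫ u, g (Real.exp u) ∂laguerreMeasure m := by
  rw [integral_laguerreMeasure, ← Real.exp_zero, ← integral_comp_exp_Ioi]
  simp_rw [exp_smul_comp_exp]

lemma integrableOn_log_pow_div_sq_iff (m : ℕ) (g : ℝ → ℝ) :
    IntegrableOn (fun x => g x * Real.log x ^ m / x ^ 2) (Set.Ioi (1 : ℝ)) ↔
      Integrable (fun u => g (Real.exp u)) (laguerreMeasure m) := by
  rw [integrable_laguerreMeasure_iff, ← Real.exp_zero, ← integrableOn_comp_exp_Ioi]
  simp_rw [exp_smul_comp_exp]

lemma integrable_exp_mul_laguerreMeasure (m : ℕ) {c : ℝ} (hc : c < 1) :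
    Integrable (fun u => Real.exp (c * u)) (laguerreMeasure m) := by
  rw [integrable_laguerreMeasure_iff]
  have h := integrableOn_rpow_mul_exp_neg_mul_rpow (p := 1) (s := m) (b := 1 - c)
    (by have : (0 : ℝ) ≤ m := m.cast_nonneg
        linarith) one_pos (by linarith)
  refine h.congr_fun (fun u hu => ?_) measurableSet_Ioi
  simp only [Real.rpow_one, Real.rpow_natCast]
  rw [mul_left_comm, ← Real.exp_add]
  ring_nf

lemma integrable_pow_laguerreMeasure (m j : ℕ) :
    Integrable (fun u => u ^ j) (laguerreMeasure m) := by
  have h := integrable_exp_mul_laguerreMeasure (m + j) (c := 0) one_pos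
  rw [integrable_laguerreMeasure_iff] at h ⊢
  refine h.congr_fun (fun u _ => ?_) measurableSet_Ioi
  simp only [zero_mul, Real.exp_zero]
  ring

lemma integral_pow_laguerreMeasure (m j : ℕ) :
    ∫ u, u ^ j ∂laguerreMeasure m = (Nat.factorial (m + j) : ℝ) := by
  rw [integral_laguerreMeasure, ← Real.Gamma_nat_eq_factorial,
    Real.Gamma_eq_integral (by positivity)]
  refine setIntegral_congr_fun measurableSet_Ioi fun u _ => ?_
  simp only [add_sub_cancel_right, Real.rpow_natCast]
  ring

instance (m : ℕ) : IsFiniteMeasure (laguerreMeasure m) := by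
  have h := integrable_pow_laguerreMeasure m 0
  simp only [pow_zero] at h
  exact (integrable_const_iff_isFiniteMeasure one_ne_zero).1 h

lemma memLp_pow_laguerreMeasure (m j : ℕ) : MemLp (fun u => u ^ j) 2 (laguerreMeasure m) := by
  rw [memLp_two_iff_integrable_sq (by fun_prop)]
  simpa only [← pow_mul] using integrable_pow_laguerreMeasure m (j * 2)

lemma memLp_exp_mul_laguerreMeasure (m : ℕ) {c : ℝ} (hc : c < 1 / 2) :
    MemLp (fun u => Real.exp (c * u)) 2 (laguerreMeasure m) := by
  rw [memLp_two_iff_integrable_sq (by fun_prop)]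
  have := integrable_exp_mul_laguerreMeasure m (c := 2 * c) (by linarith)
  refine this.congr (ae_of_all _ fun u => ?_)
  simp only
  rw [← Real.exp_nat_mul]
  push_cast
  ring_nf

open ProbabilityTheory in
/-- Finite measures on `ℝ` with finite exponential moments are determined by their moments. -/
lemma ext_of_forall_integral_pow_eq {μ ν : Measure ℝ} [IsFiniteMeasure μ] [IsFiniteMeasure ν]
    (hμ : 0 ∈ interior (integrableExpSet id μ)) (hν : 0 ∈ interior (integrableExpSet id ν))
    (h : ∀ n : ℕ, ∫ x, x ^ n ∂μ = ∫ x, x ^ n ∂ν) : μ = ν := by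
  have hder (ρ : Measure ℝ) (hρ : 0 ∈ interior (integrableExpSet id ρ)) (n : ℕ) :
      iteratedDeriv n (complexMGF id ρ) 0 = ((∫ x, x ^ n ∂ρ : ℝ) : ℂ) := by
    rw [iteratedDeriv_complexMGF (by simpa using hρ), ← integral_complex_ofReal]
    simp
  have hpow (ρ : Measure ℝ) (hρ : 0 ∈ interior (integrableExpSet id ρ)) :=
    (analyticAt_complexMGF (X := id) (μ := ρ) (z := 0) (by simpa using hρ)).hasFPowerSeriesAt
  have hev : complexMGF id μ =ᶠ[𝓝 0] complexMGF id ν := by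
    have h1 := hpow μ hμ
    simp_rw [hder μ hμ, h, ← hder ν hν] at h1
    exact h1.eventually_hasSum_sub.and (hpow ν hν).eventually_hasSum_sub |>.mono
      fun z hz => hz.1.unique hz.2
  have hstrip : Set.EqOn (complexMGF id μ) (complexMGF id ν)
      {z | z.re ∈ interior (integrableExpSet id μ) ∩ interior (integrableExpSet id ν)} := by
    refine AnalyticOnNhd.eqOn_of_preconnected_of_eventuallyEq (z₀ := 0)
      (analyticOnNhd_complexMGF.mono fun z hz => hz.1)
      (analyticOnNhd_complexMGF.mono fun z hz => hz.2) ?_ ⟨by simpa using hμ, by simpa using hν⟩ hev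
    exact ((convex_integrableExpSet.interior.inter
      convex_integrableExpSet.interior).linear_preimage Complex.reLm).isPreconnected
  refine Measure.ext_of_charFun (funext fun t => ?_)
  rw [← complexMGF_id_mul_I, ← complexMGF_id_mul_I]
  exact hstrip ⟨by simpa using hμ, by simpa using hν⟩

lemma sum_choose_mul_choose_eq (a n j : ℕ) (hj : j ≤ n) :
    ∑ k ∈ range (n + 1), (-1 : ℝ) ^ (n - k) * (n.choose k : ℝ) * ((a + k).choose j : ℝ) =
      if j = n then 1 else 0 := by
  have h1 := fwdDiff_iter_eq_sum_shift (1 : ℕ) (fun x => (x.choose j : ℤ)) n a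
  have h2 : (fwdDiff (1 : ℕ))^[n] (fun x => (x.choose j : ℤ)) a = if j = n then 1 else 0 := by
    obtain ⟨d, rfl⟩ := Nat.exists_eq_add_of_le hj
    rw [add_comm j d, Function.iterate_add_apply]
    have := fwdDiff_iter_choose 0 j
    simp only [add_zero, Nat.choose_zero_right] at this
    rw [this]
    rcases d with _ | d
    · simp
    · rw [Function.iterate_succ_apply]
      have h0 : fwdDiff (1 : ℕ) (fun _ : ℕ => ((1 : ℕ) : ℤ)) = 0 := by
        ext x
        simp [fwdDiff]
      rw [h0, if_neg (by lia)]
      have := fwdDiff_iter_const_smul (h := (1 : ℕ)) (0 : ℤ) (0 : ℕ → ℤ) d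
      simp only [zero_smul] at this
      rw [this]
      rfl
  rw [h2] at h1
  have h3 := congrArg (Int.cast : ℤ → ℝ) h1
  push_cast [smul_eq_mul, nsmul_eq_mul, mul_one] at h3
  simpa only [mul_one] using h3.symm

lemma hasDerivAt_log_pow_div (j : ℕ) {t : ℝ} (ht : 0 < t) :
    HasDerivAt (fun x => Real.log x ^ j / x)
      ((j * Real.log t ^ (j - 1) - Real.log t ^ j) / t ^ 2) t := by
  have h := ((Real.hasDerivAt_log ht.ne').pow j).div (hasDerivAt_id t) ht.ne'
  refine h.congr_deriv ?_
  simp only [id, Pi.pow_apply]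
  field_simp

lemma continuousOn_deriv_log_pow_div (j : ℕ) :
    ContinuousOn (fun t => (j * Real.log t ^ (j - 1) - Real.log t ^ j) / t ^ 2)
      (Set.Ioi (0 : ℝ)) := by
  have h : ContinuousOn Real.log (Set.Ioi (0 : ℝ)) :=
    Real.continuousOn_log.mono fun t ht => (ne_of_gt ht : t ≠ 0)
  refine ContinuousOn.div (by fun_prop) (by fun_prop) fun t ht => ?_
  exact pow_ne_zero 2 (ne_of_gt ht : t ≠ 0)

lemma sum_log_pow_div_sub (j : ℕ) {N : ℕ} (hN : 1 ≤ N) :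
    (∑ k ∈ Finset.range N, Real.log ((k : ℝ) + 1) ^ j / ((k : ℝ) + 1)) -
      Real.log (N : ℝ) ^ (j + 1) / ((j : ℝ) + 1) =
    0 ^ j + ∫ t in (1 : ℝ)..N,
      Int.fract t * ((j * Real.log t ^ (j - 1) - Real.log t ^ j) / t ^ 2) := by
  set f : ℝ → ℝ := fun x => Real.log x ^ j / x with hf
  set f' : ℝ → ℝ := fun t => (j * Real.log t ^ (j - 1) - Real.log t ^ j) / t ^ 2 with hf'
  have hN' : (1 : ℝ) ≤ N := by exact_mod_cast hN
  have hN0 : (0 : ℝ) < N := by linarith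
  have hsub : Set.Icc (1 : ℝ) N ⊆ Set.Ioi 0 := fun t ht => lt_of_lt_of_le one_pos ht.1
  have hcont : ContinuousOn f' (Set.Icc (1 : ℝ) N) := (continuousOn_deriv_log_pow_div j).mono hsub
  have hdiff : ∀ t ∈ Set.Icc (1 : ℝ) N, HasDerivAt f (f' t) t :=
    fun t ht => hasDerivAt_log_pow_div j (hsub ht)
  have habel := sum_mul_eq_sub_integral_mul₀' (f := f) (fun k => if k = 0 then 0 else 1) (by simp) N
    (fun t ht => (hdiff t ht).differentiableAt)
    ((hcont.integrableOn_Icc).congr_fun (fun t ht => (hdiff t ht).deriv.symm) measurableSet_Icc)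
  have hsumc (M : ℕ) : (∑ k ∈ Icc 0 M, if k = 0 then (0 : ℝ) else 1) = M := by
    rw [← Nat.range_succ_eq_Icc_zero, Finset.sum_range_succ']
    simp
  simp only [hsumc] at habel
  rw [← Nat.range_succ_eq_Icc_zero, Finset.sum_range_succ'] at habel
  simp only [Nat.cast_add, Nat.cast_one, if_true, mul_zero, add_zero, Nat.succ_ne_zero, if_false,
    mul_one] at habel
  have hint1 : IntervalIntegrable (fun t => t * f' t) volume 1 N := by
    refine ContinuousOn.intervalIntegrable ?_
    rw [Set.uIcc_of_le hN']
    exact continuousOn_id.mul hcont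
  have hint2 : IntervalIntegrable (fun t => Int.fract t * f' t) volume 1 N := by
    have h0 : IntervalIntegrable f' volume 1 N :=
      ContinuousOn.intervalIntegrable (by rwa [Set.uIcc_of_le hN'])
    refine h0.mono_fun
      (measurable_fract.aestronglyMeasurable.mul h0.def'.aestronglyMeasurable) ?_
    refine ae_of_all _ fun t => ?_
    simp only [norm_mul, Real.norm_eq_abs, Int.abs_fract]
    exact mul_le_of_le_one_left (abs_nonneg _) (Int.fract_lt_one t).le
  have hftc : ∫ t in (1 : ℝ)..N, t * f' t =
      (Real.log N ^ j - Real.log N ^ (j + 1) / (j + 1)) - (0 ^ j) := by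
    have hj : (j : ℝ) + 1 ≠ 0 := by positivity
    have hd : ∀ t ∈ Set.uIcc (1 : ℝ) N,
        HasDerivAt (fun x => Real.log x ^ j - Real.log x ^ (j + 1) / (j + 1)) (t * f' t) t := by
      intro t ht
      rw [Set.uIcc_of_le hN'] at ht
      have ht0 : 0 < t := hsub ht
      have hl := Real.hasDerivAt_log ht0.ne'
      refine ((hl.pow j).sub ((hl.pow (j + 1)).div_const ((j : ℝ) + 1))).congr_deriv ?_
      simp only [hf', Nat.add_sub_cancel]
      push_cast
      field_simp
    rw [intervalIntegral.integral_eq_sub_of_hasDerivAt hd hint1]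
    simp
  have hfloor : ∫ t in Set.Ioc (1 : ℝ) N, deriv f t * (⌊t⌋₊ : ℝ) =
      (∫ t in (1 : ℝ)..N, t * f' t) - ∫ t in (1 : ℝ)..N, Int.fract t * f' t := by
    rw [← intervalIntegral.integral_sub hint1 hint2, intervalIntegral.integral_of_le hN']
    refine setIntegral_congr_fun measurableSet_Ioc fun t ht => ?_
    have ht' : t ∈ Set.Icc (1 : ℝ) N := ⟨ht.1.le, ht.2⟩
    rw [(hdiff t ht').deriv, natCast_floor_eq_intCast_floor (by linarith [ht'.1]), Int.fract]
    ring
  rw [hfloor, hftc] at habel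
  have hlast : f N * (N : ℝ) = Real.log N ^ j := by
    simp only [hf]
    field_simp
  rw [habel, hlast]
  ring

lemma stieltjes_eq_integral (j : ℕ)
    (hint : IntegrableOn (fun t : ℝ =>
      Int.fract t * ((j * Real.log t ^ (j - 1) - Real.log t ^ j) / t ^ 2)) (Set.Ioi 1)) :
    stieltjes j = 0 ^ j + ∫ t in Set.Ioi (1 : ℝ),
      Int.fract t * ((j * Real.log t ^ (j - 1) - Real.log t ^ j) / t ^ 2) := by
  refine Tendsto.limUnder_eq ?_
  have h := (intervalIntegral_tendsto_integral_Ioi 1 hint tendsto_natCast_atTop_atTop).const_add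
    ((0 : ℝ) ^ j)
  refine h.congr' ?_
  filter_upwards [eventually_ge_atTop 1] with N hN
  exact (sum_log_pow_div_sub j hN).symm

lemma integrable_fract_exp (m : ℕ) :
    Integrable (fun u => Int.fract (Real.exp u)) (laguerreMeasure m) := by
  refine Integrable.of_bound
    (measurable_fract.comp Real.measurable_exp).aestronglyMeasurable 1 (ae_of_all _ fun u => ?_)
  rw [Real.norm_eq_abs, Int.abs_fract]
  exact (Int.fract_lt_one _).le

/-- The normalized logarithmic moments of the fractional part. -/
noncomputable def fractMoment (m : ℕ) : ℝ :=
  (∫ u, Int.fract (Real.exp u) ∂laguerreMeasure m) / (Nat.factorial m : ℝ)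

lemma stieltjes_zero : stieltjes 0 = 1 - fractMoment 0 := by
  have h0 := (integrableOn_log_pow_div_sq_iff 0 Int.fract).2 (integrable_fract_exp 0)
  have e : (fun t : ℝ => Int.fract t *
      (((0 : ℕ) * Real.log t ^ (0 - 1) - Real.log t ^ 0) / t ^ 2)) =
      fun t => -(Int.fract t * Real.log t ^ 0 / t ^ 2) := by
    ext t
    push_cast
    ring
  rw [stieltjes_eq_integral 0 (by rw [e]; exact h0.neg), e, integral_neg,
    integral_log_pow_div_sq, fractMoment]
  simp
  ring

lemma stieltjes_succ_div (j : ℕ) :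
    stieltjes (j + 1) / (Nat.factorial (j + 1) : ℝ) = fractMoment j - fractMoment (j + 1) := by
  have h0 := (integrableOn_log_pow_div_sq_iff j Int.fract).2 (integrable_fract_exp j)
  have h1 := (integrableOn_log_pow_div_sq_iff (j + 1) Int.fract).2 (integrable_fract_exp (j + 1))
  have e : (fun t : ℝ => Int.fract t *
      (((j + 1 : ℕ) * Real.log t ^ (j + 1 - 1) - Real.log t ^ (j + 1)) / t ^ 2)) =
      fun t => ((j : ℝ) + 1) * (Int.fract t * Real.log t ^ j / t ^ 2) -
        Int.fract t * Real.log t ^ (j + 1) / t ^ 2 := by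
    ext t
    rw [Nat.add_sub_cancel]
    push_cast
    ring
  rw [stieltjes_eq_integral (j + 1) (by rw [e]; exact (h0.const_mul _).sub h1), e,
    integral_sub (h0.const_mul _) h1, integral_const_mul, integral_log_pow_div_sq,
    integral_log_pow_div_sq, fractMoment, fractMoment, Nat.factorial_succ]
  have := Nat.factorial_ne_zero j
  push_cast
  field_simp
  simp

lemma sum_stieltjes_div_factorial (M : ℕ) :
    ∑ j ∈ Finset.range (M + 1), stieltjes j / (Nat.factorial j : ℝ) = 1 - fractMoment M := by
  induction M with
  | zero => simp [stieltjes_zero]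
  | succ M ih =>
    rw [Finset.sum_range_succ, ih, stieltjes_succ_div]
    ring

lemma ellGen_eq_sum_fractMoment (n m : ℕ) :
    ellGen n m = -∑ k ∈ Finset.range (n + 1),
      (n.choose k : ℝ) * (-1 : ℝ) ^ (n - k) * fractMoment (m + k) := by
  have h := sum_choose_mul_choose_eq 0 n 0 n.zero_le
  simp only [Nat.choose_zero_right, Nat.cast_one, mul_one] at h
  have h' : ∑ k ∈ Finset.range (n + 1), (n.choose k : ℝ) * (-1 : ℝ) ^ (n - k) =
      if n = 0 then 1 else 0 := by
    simp_rw [mul_comm (n.choose _ : ℝ), h, eq_comm (a := 0)]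
  rw [ellGen]
  simp_rw [sum_stieltjes_div_factorial, mul_sub, mul_one, Finset.sum_sub_distrib]
  rw [h']
  ring

lemma choose_div_factorial_eq (m n k : ℕ) (hk : k ≤ n) :
    ((n + m).choose (n - k) : ℝ) / (Nat.factorial k : ℝ) =
      (Nat.factorial (n + m) : ℝ) / (Nat.factorial n : ℝ) *
        ((n.choose k : ℝ) / (Nat.factorial (m + k) : ℝ)) := by
  rw [Nat.cast_choose ℝ (show n - k ≤ n + m by lia), Nat.cast_choose ℝ hk,
    show n + m - (n - k) = m + k by lia]
  have h1 := Nat.factorial_ne_zero (n - k)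
  have h2 := Nat.factorial_ne_zero k
  have h3 := Nat.factorial_ne_zero n
  have h4 := Nat.factorial_ne_zero (m + k)
  field_simp

lemma assocLaguerre_eq_sum (m n : ℕ) (u : ℝ) :
    assocLaguerre m n u = (Nat.factorial (n + m) : ℝ) / (Nat.factorial n : ℝ) *
      ∑ k ∈ Finset.range (n + 1),
        (n.choose k : ℝ) * (-1 : ℝ) ^ k / (Nat.factorial (m + k) : ℝ) * u ^ k := by
  rw [assocLaguerre, Finset.mul_sum]
  refine Finset.sum_congr rfl fun k hk => ?_
  have h := choose_div_factorial_eq m n k (Nat.lt_succ_iff.1 (Finset.mem_range.1 hk))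
  calc _ = ((n + m).choose (n - k) : ℝ) / (Nat.factorial k : ℝ) * ((-1) ^ k * u ^ k) := by ring
    _ = _ := by rw [h]; ring

lemma memLp_fract_exp (m : ℕ) :
    MemLp (fun u => Int.fract (Real.exp u)) 2 (laguerreMeasure m) := by
  refine MemLp.of_bound
    (measurable_fract.comp Real.measurable_exp).aestronglyMeasurable 1 (ae_of_all _ fun u => ?_)
  rw [Real.norm_eq_abs, Int.abs_fract]
  exact (Int.fract_lt_one _).le

lemma memLp_assocLaguerre (m n : ℕ) : MemLp (assocLaguerre m n) 2 (laguerreMeasure m) := by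
  rw [funext (assocLaguerre_eq_sum m n)]
  exact (memLp_finsetSum _ fun k _ => (memLp_pow_laguerreMeasure m k).const_mul _).const_mul _

lemma integral_mul_pow_laguerreMeasure (m j : ℕ) (f : ℝ → ℝ) :
    ∫ u, f u * u ^ j ∂laguerreMeasure m = ∫ u, f u ∂laguerreMeasure (m + j) := by
  rw [integral_laguerreMeasure, integral_laguerreMeasure]
  refine integral_congr_ae (ae_of_all _ fun u => ?_)
  simp only
  ring

lemma integral_mul_assocLaguerre {m : ℕ} (n : ℕ) {g : ℝ → ℝ} (hg : MemLp g 2 (laguerreMeasure m)) :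
    ∫ u, g u * assocLaguerre m n u ∂laguerreMeasure m =
      (Nat.factorial (n + m) : ℝ) / (Nat.factorial n : ℝ) *
      ∑ k ∈ Finset.range (n + 1),
        (n.choose k : ℝ) * (-1 : ℝ) ^ k / (Nat.factorial (m + k) : ℝ) *
          ∫ u, g u * u ^ k ∂laguerreMeasure m := by
  have hint (k : ℕ) : Integrable (fun u => g u * u ^ k) (laguerreMeasure m) :=
    hg.integrable_mul (memLp_pow_laguerreMeasure m k)
  simp_rw [assocLaguerre_eq_sum, ← integral_const_mul]
  rw [← integral_finsetSum _ fun k _ => (hint k).const_mul _, ← integral_const_mul]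
  refine integral_congr_ae (ae_of_all _ fun u => ?_)
  simp only [Finset.mul_sum]
  refine Finset.sum_congr rfl fun k _ => ?_
  ring

lemma integral_pow_mul_assocLaguerre (m n j : ℕ) (hj : j ≤ n) :
    ∫ u, u ^ j * assocLaguerre m n u ∂laguerreMeasure m =
      if j = n then (-1) ^ n * (Nat.factorial (n + m) : ℝ) else 0 := by
  rw [integral_mul_assocLaguerre n (memLp_pow_laguerreMeasure m j)]
  simp_rw [integral_mul_pow_laguerreMeasure, integral_pow_laguerreMeasure]
  have hterm : ∀ k ∈ Finset.range (n + 1),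
      (n.choose k : ℝ) * (-1 : ℝ) ^ k / (Nat.factorial (m + k) : ℝ) *
        (Nat.factorial (m + k + j) : ℝ) =
      ((-1) ^ n * (Nat.factorial j : ℝ)) *
        ((-1 : ℝ) ^ (n - k) * (n.choose k : ℝ) * ((m + j + k).choose j : ℝ)) := by
    intro k hk
    have hk' : k ≤ n := Nat.lt_succ_iff.1 (Finset.mem_range.1 hk)
    rw [Nat.cast_choose ℝ (show j ≤ m + j + k by lia), show m + j + k - j = m + k by lia,
      show m + j + k = m + k + j by ring]
    have hs : (-1 : ℝ) ^ n * (-1) ^ (n - k) = (-1) ^ k := by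
      rw [← pow_add, show n + (n - k) = k + 2 * (n - k) by lia, pow_add, pow_mul]
      simp
    have h1 := Nat.factorial_ne_zero (m + k)
    have h2 := Nat.factorial_ne_zero j
    rw [← hs]
    field_simp
  rw [Finset.sum_congr rfl hterm, ← Finset.mul_sum, sum_choose_mul_choose_eq _ _ _ hj]
  have := Nat.factorial_ne_zero n
  split_ifs with h
  · subst h
    field_simp
  · simp

lemma integral_assocLaguerre_mul_assocLaguerre_of_le (m : ℕ) {k n : ℕ} (hk : k ≤ n) :
    ∫ u, assocLaguerre m n u * assocLaguerre m k u ∂laguerreMeasure m =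
      if k = n then (Nat.factorial (n + m) : ℝ) / (Nat.factorial n : ℝ) else 0 := by
  rw [integral_mul_assocLaguerre k (memLp_assocLaguerre m n)]
  simp_rw [mul_comm (assocLaguerre m n _)]
  rw [Finset.sum_range_succ, Finset.sum_eq_zero, integral_pow_mul_assocLaguerre m n k hk]
  · split_ifs with h
    · subst h
      have h1 := Nat.factorial_ne_zero k
      have h2 := Nat.factorial_ne_zero (k + m)
      have hs : (-1 : ℝ) ^ k * (-1) ^ k = 1 := by rw [← mul_pow]; simp
      rw [add_comm m k, Nat.choose_self]
      field_simp
      rw [zero_add, Nat.cast_one, one_mul, sq, hs]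
    · simp
  · intro i hi
    have hi' := Finset.mem_range.1 hi
    rw [integral_pow_mul_assocLaguerre m n i (by lia), if_neg (by lia), mul_zero]

lemma integral_assocLaguerre_mul_assocLaguerre (m k n : ℕ) :
    ∫ u, assocLaguerre m n u * assocLaguerre m k u ∂laguerreMeasure m =
      if k = n then (Nat.factorial (n + m) : ℝ) / (Nat.factorial n : ℝ) else 0 := by
  rcases le_total k n with h | h
  · exact integral_assocLaguerre_mul_assocLaguerre_of_le m h
  · simp_rw [mul_comm (assocLaguerre m n _)]
    rw [integral_assocLaguerre_mul_assocLaguerre_of_le m h]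
    by_cases hkn : k = n
    · simp [hkn]
    · simp [hkn, Ne.symm hkn]

lemma integral_mul_pow_eq_zero {m : ℕ} {g : ℝ → ℝ} (hg : MemLp g 2 (laguerreMeasure m))
    (h : ∀ n, ∫ u, g u * assocLaguerre m n u ∂laguerreMeasure m = 0) (n : ℕ) :
    ∫ u, g u * u ^ n ∂laguerreMeasure m = 0 := by
  induction n using Nat.strong_induction_on with
  | _ n ih =>
    have hn := h n
    have h1 := Nat.factorial_ne_zero n
    have h2 := Nat.factorial_ne_zero (n + m)
    have h3 := Nat.factorial_ne_zero (m + n)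
    rw [integral_mul_assocLaguerre n hg, Finset.sum_range_succ, Finset.sum_eq_zero] at hn
    · simpa [h1, h2, h3] using hn
    · intro i hi
      rw [ih i (Finset.mem_range.1 hi), mul_zero]

lemma ellGen_eq_integral_laguerreMeasure (n m : ℕ) :
    ellGen n m =
      (-1 : ℝ) ^ (n + 1) / ((Nat.factorial m : ℝ) * ((n + m).choose m : ℝ)) *
        ∫ u, Int.fract (Real.exp u) * assocLaguerre m n u ∂laguerreMeasure m := by
  rw [integral_mul_assocLaguerre n (memLp_fract_exp m), ellGen_eq_sum_fractMoment,
    Nat.cast_choose ℝ (Nat.le_add_left m n), Nat.add_sub_cancel, ← mul_assoc]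
  have h1 := Nat.factorial_ne_zero m
  have h2 := Nat.factorial_ne_zero n
  have h3 := Nat.factorial_ne_zero (n + m)
  have hc : (-1 : ℝ) ^ (n + 1) / ((Nat.factorial m : ℝ) * ((Nat.factorial (n + m) : ℝ) /
      ((Nat.factorial m : ℝ) * (Nat.factorial n : ℝ)))) *
      ((Nat.factorial (n + m) : ℝ) / (Nat.factorial n : ℝ)) = (-1) ^ (n + 1) := by
    field_simp
  rw [hc, ← Finset.sum_neg_distrib, Finset.mul_sum]
  refine Finset.sum_congr rfl fun k hk => ?_
  have hk' : k ≤ n := Nat.lt_succ_iff.1 (Finset.mem_range.1 hk)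
  have hs : (-1 : ℝ) ^ (n + 1) * (-1) ^ k = -(-1) ^ (n - k) := by
    rw [← pow_add, show n + 1 + k = (n - k) + 1 + 2 * k by lia, pow_add, pow_add, pow_mul]
    simp
  rw [integral_mul_pow_laguerreMeasure, fractMoment]
  linear_combination -((n.choose k : ℝ) / (Nat.factorial (m + k) : ℝ) *
    ∫ u, Int.fract (Real.exp u) ∂laguerreMeasure (m + k)) * hs

open ProbabilityTheory in
/-- A square-integrable function orthogonal to all powers vanishes almost everywhere. -/
lemma ae_eq_zero_of_forall_integral_mul_pow_eq_zero {m : ℕ} {g : ℝ → ℝ}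
    (hg : MemLp g 2 (laguerreMeasure m))
    (h : ∀ n : ℕ, ∫ u, g u * u ^ n ∂laguerreMeasure m = 0) :
    g =ᵐ[laguerreMeasure m] 0 := by
  set μ := laguerreMeasure m with hμ
  have hdens (f : ℝ → ℝ) (hf : MemLp f 2 μ) (hf0 : 0 ≤ f) :
      IsFiniteMeasure (μ.withDensity fun u => ENNReal.ofReal (f u)) ∧
      0 ∈ interior (integrableExpSet id (μ.withDensity fun u => ENNReal.ofReal (f u))) ∧
      ∀ n : ℕ, ∫ u, u ^ n ∂(μ.withDensity fun u => ENNReal.ofReal (f u)) =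
        ∫ u, f u * u ^ n ∂μ := by
    have hfm : AEMeasurable (fun u => ENNReal.ofReal (f u)) μ :=
      hf.aestronglyMeasurable.aemeasurable.ennreal_ofReal
    refine ⟨isFiniteMeasure_withDensity_ofReal (hf.integrable one_le_two).2, ?_, fun n => ?_⟩
    · rw [mem_interior_iff_mem_nhds]
      filter_upwards [Iio_mem_nhds (show (0 : ℝ) < 1 / 2 by norm_num)] with c hc
      simp only [integrableExpSet, Set.mem_ofPred_eq, id]
      rw [integrable_withDensity_iff_integrable_smul₀' hfm
        (ae_of_all _ fun _ => ENNReal.ofReal_lt_top)]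
      refine (hf.integrable_mul (memLp_exp_mul_laguerreMeasure m hc)).congr
        (ae_of_all _ fun u => ?_)
      simp [ENNReal.toReal_ofReal (hf0 u)]
    · rw [integral_withDensity_eq_integral_toReal_smul₀ hfm
        (ae_of_all _ fun _ => ENNReal.ofReal_lt_top)]
      simp_rw [ENNReal.toReal_ofReal (hf0 _), smul_eq_mul]
  have hp : MemLp (fun u => max (g u) 0) 2 μ := hg.pos_part
  have hn : MemLp (fun u => max (-g u) 0) 2 μ := hg.neg_part
  obtain ⟨hp1, hp2, hp3⟩ := hdens _ hp fun u => le_max_right _ _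
  obtain ⟨hn1, hn2, hn3⟩ := hdens _ hn fun u => le_max_right _ _
  have hint (f : ℝ → ℝ) (hf : MemLp f 2 μ) (n : ℕ) : Integrable (fun u => f u * u ^ n) μ :=
    hf.integrable_mul (memLp_pow_laguerreMeasure m n)
  have heq := ext_of_forall_integral_pow_eq hp2 hn2 fun n => by
    rw [hp3, hn3, ← sub_eq_zero, ← integral_sub (hint _ hp n) (hint _ hn n)]
    refine (integral_congr_ae (ae_of_all _ fun u => ?_)).trans (h n)
    have hgu := max_zero_sub_eq_self (g u)
    linear_combination u ^ n * hgu
  rw [withDensity_eq_iff_of_sigmaFinite hp.aestronglyMeasurable.aemeasurable.ennreal_ofReal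
    hn.aestronglyMeasurable.aemeasurable.ennreal_ofReal] at heq
  filter_upwards [heq] with u hu
  rw [ENNReal.ofReal_eq_ofReal_iff (le_max_right _ _) (le_max_right _ _)] at hu
  have := max_zero_sub_eq_self (g u)
  exact this.symm.trans (sub_eq_zero.2 hu)

/-- The normalized Laguerre polynomials as elements of `L²`. -/
noncomputable def laguerreVector (m n : ℕ) : Lp ℝ 2 (laguerreMeasure m) :=
  √((Nat.factorial n : ℝ) / (Nat.factorial (n + m) : ℝ)) • (memLp_assocLaguerre m n).toLp

lemma inner_toLp_laguerreVector {m : ℕ} (n : ℕ) {g : ℝ → ℝ} (hg : MemLp g 2 (laguerreMeasure m)) :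
    inner ℝ hg.toLp (laguerreVector m n) =
      √((Nat.factorial n : ℝ) / (Nat.factorial (n + m) : ℝ)) *
        ∫ u, g u * assocLaguerre m n u ∂laguerreMeasure m := by
  rw [laguerreVector, real_inner_smul_right, L2.inner_def]
  congr 1
  refine integral_congr_ae ?_
  filter_upwards [hg.coeFn_toLp, (memLp_assocLaguerre m n).coeFn_toLp] with u h1 h2
  rw [h1, h2]
  exact mul_comm _ _

lemma orthonormal_laguerreVector (m : ℕ) : Orthonormal ℝ (laguerreVector m) := by
  rw [orthonormal_iff_ite]
  intro i j
  rw [laguerreVector, real_inner_smul_left, inner_toLp_laguerreVector,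
    integral_assocLaguerre_mul_assocLaguerre]
  have h1 := Nat.factorial_pos i
  have h2 := Nat.factorial_pos (i + m)
  by_cases h : i = j
  · subst h
    rw [if_pos rfl, if_pos rfl, ← mul_assoc, Real.mul_self_sqrt (by positivity)]
    field_simp
  · rw [if_neg h, if_neg (Ne.symm h), mul_zero, mul_zero]

lemma orthogonal_span_laguerreVector (m : ℕ) :
    (Submodule.span ℝ (Set.range (laguerreVector m)))ᗮ = ⊥ := by
  rw [Submodule.eq_bot_iff]
  intro g hg
  have hgL := Lp.memLp g
  have h (n : ℕ) : ∫ u, g u * assocLaguerre m n u ∂laguerreMeasure m = 0 := by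
    have h0 := (Submodule.mem_orthogonal' _ _).1 hg _ (Submodule.subset_span ⟨n, rfl⟩)
    rw [← Lp.toLp_coeFn g hgL, inner_toLp_laguerreVector] at h0
    have h1 := Nat.factorial_pos n
    have h2 := Nat.factorial_pos (n + m)
    exact (mul_eq_zero.1 h0).resolve_left (by positivity)
  rw [Lp.eq_zero_iff_ae_eq_zero]
  exact ae_eq_zero_of_forall_integral_mul_pow_eq_zero hgL (integral_mul_pow_eq_zero hgL h)

lemma hasSum_sq_integral_mul_assocLaguerre {m : ℕ} {g : ℝ → ℝ}
    (hg : MemLp g 2 (laguerreMeasure m)) :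
    HasSum (fun n : ℕ => (Nat.factorial n : ℝ) / (Nat.factorial (n + m) : ℝ) *
      (∫ u, g u * assocLaguerre m n u ∂laguerreMeasure m) ^ 2)
      (∫ u, g u ^ 2 ∂laguerreMeasure m) := by
  have h := (HilbertBasis.mkOfOrthogonalEqBot (orthonormal_laguerreVector m)
    (orthogonal_span_laguerreVector m)).hasSum_inner_mul_inner hg.toLp hg.toLp
  simp only [HilbertBasis.coe_mkOfOrthogonalEqBot] at h
  convert! h using 1
  · ext n
    rw [real_inner_comm hg.toLp, inner_toLp_laguerreVector, ← sq, mul_pow, Real.sq_sqrt (by positivity)]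
  · rw [L2.inner_def]
    refine integral_congr_ae ?_
    filter_upwards [hg.coeFn_toLp] with u h1
    rw [h1, sq]
    rfl

theorem statement18 (m : ℕ) :
    Summable (fun n : ℕ => ((n + m).choose m : ℝ) * ellGen n m ^ 2) ∧
    IntegrableOn (fun x : ℝ => Int.fract x ^ 2 * Real.log x ^ m / x ^ 2) (Set.Ioi (1 : ℝ)) ∧
    (∑' n : ℕ, ((n + m).choose m : ℝ) * ellGen n m ^ 2) =
      (1 / (Nat.factorial m : ℝ)) *
        ∫ x in Set.Ioi (1 : ℝ), Int.fract x ^ 2 * Real.log x ^ m / x ^ 2 ∧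
    ∀ n : ℕ, ellGen n m =
      ((-1 : ℝ) ^ (n + 1) / ((Nat.factorial m : ℝ) * ((n + m).choose m : ℝ))) *
        ∫ x in Set.Ioi (1 : ℝ),
          Int.fract x * Real.log x ^ m * assocLaguerre m n (Real.log x) / x ^ 2 := by
  have hsum : HasSum (fun n : ℕ => ((n + m).choose m : ℝ) * ellGen n m ^ 2)
      ((1 / (Nat.factorial m : ℝ)) *
        ∫ x in Set.Ioi (1 : ℝ), Int.fract x ^ 2 * Real.log x ^ m / x ^ 2) := by
    rw [integral_log_pow_div_sq m (fun x => Int.fract x ^ 2)]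
    convert! (hasSum_sq_integral_mul_assocLaguerre (memLp_fract_exp m)).mul_left _ using 2 with n
    rw [ellGen_eq_integral_laguerreMeasure, mul_pow, div_pow, ← pow_mul, mul_comm (n + 1),
      pow_mul, neg_one_sq, one_pow, Nat.cast_choose ℝ (Nat.le_add_left m n), Nat.add_sub_cancel]
    have h1 := Nat.factorial_ne_zero m
    have h2 := Nat.factorial_ne_zero n
    have h3 := Nat.factorial_ne_zero (n + m)
    field_simp
  refine ⟨hsum.summable, ?_, hsum.tsum_eq, fun n => ?_⟩
  · rw [integrableOn_log_pow_div_sq_iff m (fun x => Int.fract x ^ 2)]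
    exact (memLp_fract_exp m).integrable_sq
  · have h := integral_log_pow_div_sq m (fun x => Int.fract x * assocLaguerre m n (Real.log x))
    simp only [Real.log_exp] at h
    rw [ellGen_eq_integral_laguerreMeasure, ← h]
    simp_rw [mul_right_comm]
end
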